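/- arXiv:2406.03945 — 2 statements merged into one kernel-verified Lean document; each statement's English description precedes it below -/
import Mathlib

section
/- Let ρ be a two-qubit state with ‖b(ρ)‖ < 1, let f_B be an invertible 2×2 complex matrix, and let ρ'_FB = (𝟙⊗f_B)ρ(𝟙⊗f_B)†/tr[(𝟙⊗f_B†f_B)ρ] be the Bob-filtered state; assume also ‖b(ρ'_FB)‖ < 1. Then Alice's quantum steering ellipsoid matrix is invariant: Q_A(ρ'_FB) = Q_A(ρ). -/
open Matrix Kronecker Complex
open scoped ComplexOrder

noncomputable section

/-- 2×2 complex matrices (one qubit operators). -/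
abbrev Mat2 := Matrix (Fin 2) (Fin 2) ℂ
/-- 4×4 complex matrices, indexed by ℂ²⊗ℂ² product indices (two qubit operators). -/
abbrev Mat4 := Matrix (Fin 2 × Fin 2) (Fin 2 × Fin 2) ℂ

/-- A two-qubit state: positive semidefinite with trace 1. -/
def IsState (ρ : Mat4) : Prop := ρ.PosSemidef ∧ ρ.trace = 1

/-- The Pauli matrices σ₁, σ₂, σ₃ (indexed by 0,1,2). -/
def pauli : Fin 3 → Mat2 :=
  ![!![0, 1; 1, 0], !![0, -Complex.I; Complex.I, 0], !![1, 0; 0, -1]]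

/-- Alice's Bloch vector: a_i = tr((σ_i ⊗ 𝟙)ρ). -/
def aVec (ρ : Mat4) : Fin 3 → ℝ := fun i => ((pauli i ⊗ₖ (1 : Mat2)) * ρ).trace.re
/-- Bob's Bloch vector: b_i = tr((𝟙 ⊗ σ_i)ρ). -/
def bVec (ρ : Mat4) : Fin 3 → ℝ := fun i => (((1 : Mat2) ⊗ₖ pauli i) * ρ).trace.re
/-- Correlation matrix: T_{ij} = tr((σ_i ⊗ σ_j)ρ). -/
def Tmat (ρ : Mat4) : Matrix (Fin 3) (Fin 3) ℝ :=
  Matrix.of fun i j => ((pauli i ⊗ₖ pauli j) * ρ).trace.re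

/-- Euclidean norm on ℝ³. -/
def norm3 (v : Fin 3 → ℝ) : ℝ := Real.sqrt (∑ i, v i ^ 2)

/-- Alice's quantum steering ellipsoid centre c_A = γ_b²(a − T b), γ_b² = 1/(1 − ‖b‖²). -/
def cA (ρ : Mat4) : Fin 3 → ℝ :=
  (1 - norm3 (bVec ρ) ^ 2)⁻¹ • (aVec ρ - Tmat ρ *ᵥ bVec ρ)
/-- Bob's quantum steering ellipsoid centre c_B = γ_a²(b − Tᵀ a), γ_a² = 1/(1 − ‖a‖²). -/
def cB (ρ : Mat4) : Fin 3 → ℝ :=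
  (1 - norm3 (aVec ρ) ^ 2)⁻¹ • (bVec ρ - (Tmat ρ)ᵀ *ᵥ aVec ρ)

/-- Alice's QSE matrix Q_A = γ_b²(T − a bᵀ)(𝟙₃ + γ_b² b bᵀ)(Tᵀ − b aᵀ). -/
def QA (ρ : Mat4) : Matrix (Fin 3) (Fin 3) ℝ :=
  (1 - norm3 (bVec ρ) ^ 2)⁻¹ •
    ((Tmat ρ - vecMulVec (aVec ρ) (bVec ρ)) *
      (1 + (1 - norm3 (bVec ρ) ^ 2)⁻¹ • vecMulVec (bVec ρ) (bVec ρ)) *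
      ((Tmat ρ)ᵀ - vecMulVec (bVec ρ) (aVec ρ)))

/-- Bob's QSE matrix Q_B = γ_a²(Tᵀ − b aᵀ)(𝟙₃ + γ_a² a aᵀ)(T − a bᵀ). -/
def QB (ρ : Mat4) : Matrix (Fin 3) (Fin 3) ℝ :=
  (1 - norm3 (aVec ρ) ^ 2)⁻¹ •
    (((Tmat ρ)ᵀ - vecMulVec (bVec ρ) (aVec ρ)) *
      (1 + (1 - norm3 (aVec ρ) ^ 2)⁻¹ • vecMulVec (aVec ρ) (aVec ρ)) *
      (Tmat ρ - vecMulVec (aVec ρ) (bVec ρ)))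

/-- The Alice-filtered state ρ'_FA = (f⊗𝟙)ρ(f⊗𝟙)† / tr[(f†f⊗𝟙)ρ]. -/
def filterA (ρ : Mat4) (f : Mat2) : Mat4 :=
  ((((fᴴ * f) ⊗ₖ (1 : Mat2)) * ρ).trace)⁻¹ • ((f ⊗ₖ (1 : Mat2)) * ρ * (f ⊗ₖ (1 : Mat2))ᴴ)

/-- The Bob-filtered state ρ'_FB = (𝟙⊗f)ρ(𝟙⊗f)† / tr[(𝟙⊗f†f)ρ]. -/
def filterB (ρ : Mat4) (f : Mat2) : Mat4 :=
  ((((1 : Mat2) ⊗ₖ (fᴴ * f)) * ρ).trace)⁻¹ • (((1 : Mat2) ⊗ₖ f) * ρ * ((1 : Mat2) ⊗ₖ f)ᴴ)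

/-- The two-sided filtered state (f_A⊗f_B)ρ(f_A⊗f_B)† / tr[(f_A†f_A ⊗ f_B†f_B)ρ]. -/
def filterAB (ρ : Mat4) (f g : Mat2) : Mat4 :=
  ((((fᴴ * f) ⊗ₖ (gᴴ * g)) * ρ).trace)⁻¹ • ((f ⊗ₖ g) * ρ * (f ⊗ₖ g)ᴴ)

/-- The qubit observable α·σ for α ∈ ℝ³. -/
def obs (α : Fin 3 → ℝ) : Mat2 := ∑ k, (α k : ℂ) • pauli k

/-- The expectation value ⟨A⊗B⟩_ρ = tr((A⊗B)ρ) (real for states/Hermitian observables). -/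
def expVal (ρ : Mat4) (A B : Mat2) : ℝ := ((A ⊗ₖ B) * ρ).trace.re

/-- The CHSH functional ½(⟨A¹B¹⟩+⟨A¹B²⟩+⟨A²B¹⟩−⟨A²B²⟩). -/
def chshVal (ρ : Mat4) (α1 α2 β1 β2 : Fin 3 → ℝ) : ℝ :=
  (expVal ρ (obs α1) (obs β1) + expVal ρ (obs α1) (obs β2)
    + expVal ρ (obs α2) (obs β1) - expVal ρ (obs α2) (obs β2)) / 2

/-- The maximal CHSH value B(ρ) over measurement directions (unit vectors in ℝ³). -/
def Bval (ρ : Mat4) : ℝ :=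
  sSup {x | ∃ α1 α2 β1 β2 : Fin 3 → ℝ, norm3 α1 = 1 ∧ norm3 α2 = 1 ∧
    norm3 β1 = 1 ∧ norm3 β2 = 1 ∧ x = chshVal ρ α1 α2 β1 β2}

/-- The F₃ functional (1/√3)Σᵢ tr((Aⁱ⊗σᵢ)ρ). -/
def f3Val (ρ : Mat4) (α : Fin 3 → Fin 3 → ℝ) : ℝ :=
  (∑ i, expVal ρ (obs (α i)) (pauli i)) / Real.sqrt 3

/-- The maximal F₃ value over measurement directions. -/
def F3val (ρ : Mat4) : ℝ :=
  sSup {x | ∃ α : Fin 3 → Fin 3 → ℝ, (∀ i, norm3 (α i) = 1) ∧ x = f3Val ρ α}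

/-- Partial trace over Bob (second factor). -/
def trB (M : Mat4) : Mat2 := Matrix.of fun i j => ∑ k, M (i, k) (j, k)
/-- Partial trace over Alice (first factor). -/
def trA (M : Mat4) : Mat2 := Matrix.of fun i j => ∑ k, M (k, i) (k, j)

/-- The vector |φ⁺(θ)⟩ = cosθ|00⟩ + sinθ|11⟩. -/
def phiVec (θ : ℝ) : Fin 2 × Fin 2 → ℂ :=
  fun q => if q = (0, 0) then (Real.cos θ : ℂ) else if q = (1, 1) then (Real.sin θ : ℂ) else 0

/-- The projector φ⁺(θ) = |φ⁺(θ)⟩⟨φ⁺(θ)|. -/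
def phiProj (θ : ℝ) : Mat4 := vecMulVec (phiVec θ) (star (phiVec θ))

/-- ρ_A(θ) = tr_B φ⁺(θ) = diag(cos²θ, sin²θ). -/
def rhoA (θ : ℝ) : Mat2 := !![(Real.cos θ : ℂ) ^ 2, 0; 0, (Real.sin θ : ℂ) ^ 2]

/-- Partially entangled state with one-sided coloured noise. -/
def rhoM (θ p : ℝ) : Mat4 :=
  (p : ℂ) • phiProj θ + ((1 - p : ℝ) : ℂ) • (rhoA θ ⊗ₖ ((1 / 2 : ℂ) • (1 : Mat2)))

/-- Partially entangled state with symmetric coloured noise. -/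
def rhoMM (θ p : ℝ) : Mat4 :=
  (p : ℂ) • phiProj θ + ((1 - p : ℝ) : ℂ) • (rhoA θ ⊗ₖ rhoA θ)

/-- The vector |Φ⁺⟩ = (|00⟩+|11⟩)/√2. -/
def maxEntVec : Fin 2 × Fin 2 → ℂ :=
  fun q => if q.1 = q.2 then ((Real.sqrt 2 : ℂ))⁻¹ else 0

/-- The projector Φ⁺ = |Φ⁺⟩⟨Φ⁺|. -/
def maxEntProj : Mat4 := vecMulVec maxEntVec (star maxEntVec)

/-- The singlet vector |Ψ⁻⟩ = (|01⟩−|10⟩)/√2. -/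
def singletVec : Fin 2 × Fin 2 → ℂ :=
  fun q => if q = (0, 1) then ((Real.sqrt 2 : ℂ))⁻¹
    else if q = (1, 0) then -((Real.sqrt 2 : ℂ))⁻¹ else 0

/-- The singlet projector |Ψ⁻⟩⟨Ψ⁻|. -/
def singletProj : Mat4 := vecMulVec singletVec (star singletVec)

/-- The vector |00⟩. -/
def zeroVec : Fin 2 × Fin 2 → ℂ := fun q => if q = (0, 0) then 1 else 0

/-- The quasi-distillable state ρ_QD(p) = p|Ψ⁻⟩⟨Ψ⁻| + (1−p)|00⟩⟨00|. -/
def rhoQD (p : ℝ) : Mat4 :=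
  (p : ℂ) • singletProj + ((1 - p : ℝ) : ℂ) • vecMulVec zeroVec (star zeroVec)

/-- The unnormalised Bob operator `tr_A((A ⊗ 𝟙)ρ)` steered to by Alice's operator `A`. -/
def steered (ρ : Mat4) (A : Mat2) : Mat2 :=
  Matrix.of fun k l => ∑ i, ∑ j, A i j * ρ (j, k) (i, l)

/-- The polarised determinant of 2×2 matrices: `minkowski X X = 2 det X`. It is half the Minkowski
product of the Pauli coordinates of `X` and `Y`. -/
def minkowski (X Y : Mat2) : ℂ := X.trace * Y.trace - (X * Y).trace

lemma trace_kronecker_mul (ρ : Mat4) (A B : Mat2) :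
    ((A ⊗ₖ B) * ρ).trace = (B * steered ρ A).trace := by
  simp only [Matrix.trace, Matrix.diag, Matrix.mul_apply, Fintype.sum_prod_type, Fin.sum_univ_two,
    kroneckerMap_apply, steered, Matrix.of_apply]
  ring

lemma steered_smul (ρ : Mat4) (c : ℂ) (A : Mat2) : steered (c • ρ) A = c • steered ρ A := by
  ext k l
  simp only [steered, Matrix.of_apply, Matrix.smul_apply, Fin.sum_univ_two, smul_eq_mul]
  ring

lemma steered_conj (ρ : Mat4) (f A : Mat2) :
    steered (((1 : Mat2) ⊗ₖ f) * ρ * ((1 : Mat2) ⊗ₖ f)ᴴ) A = f * steered ρ A * fᴴ := by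
  ext k l
  simp only [steered, Matrix.of_apply, Matrix.mul_apply, Fintype.sum_prod_type, Fin.sum_univ_two,
    kroneckerMap_apply, conjTranspose_apply, Matrix.one_apply]
  simp
  ring

lemma steered_isHermitian {ρ : Mat4} (hρ : ρ.IsHermitian) {A : Mat2} (hA : A.IsHermitian) :
    (steered ρ A).IsHermitian := by
  ext k l
  simp only [steered, conjTranspose_apply, Matrix.of_apply, star_sum, star_mul', hρ.apply,
    hA.apply]
  rw [Finset.sum_comm]

lemma pauli_isHermitian (i : Fin 3) : (pauli i).IsHermitian := by
  fin_cases i <;> ext k l <;> fin_cases k <;> fin_cases l <;> simp [pauli]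

lemma trace_mul_ofReal_re {X Y : Mat2} (hX : X.IsHermitian) (hY : Y.IsHermitian) :
    (((X * Y).trace.re : ℝ) : ℂ) = (X * Y).trace := by
  rw [← Complex.conj_eq_iff_re, starRingEnd_apply, ← trace_conjTranspose, conjTranspose_mul,
    hX.eq, hY.eq, trace_mul_comm]

lemma steered_one_trace (ρ : Mat4) : (steered ρ 1).trace = ρ.trace := by
  rw [← one_mul (steered ρ 1), ← trace_kronecker_mul, one_kronecker_one, one_mul]

lemma bVec_ofReal {ρ : Mat4} (hρ : ρ.IsHermitian) (k : Fin 3) :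
    (bVec ρ k : ℂ) = (pauli k * steered ρ 1).trace := by
  rw [bVec, trace_kronecker_mul,
    trace_mul_ofReal_re (pauli_isHermitian k) (steered_isHermitian hρ isHermitian_one)]

lemma minkowski_smul (c : ℂ) (X Y : Mat2) :
    minkowski (c • X) (c • Y) = c ^ 2 * minkowski X Y := by
  simp only [minkowski, trace_smul, Matrix.smul_mul, Matrix.mul_smul, smul_eq_mul]
  ring

lemma minkowski_conj (f X Y : Mat2) :
    minkowski (f * X * fᴴ) (f * Y * fᴴ) = f.det * fᴴ.det * minkowski X Y := by
  generalize fᴴ = g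
  simp only [minkowski, Matrix.trace_fin_two, Matrix.mul_apply, Fin.sum_univ_two, det_fin_two]
  ring

lemma two_mul_minkowski (X Y : Mat2) :
    2 * minkowski X Y =
      X.trace * Y.trace - ∑ i, (pauli i * X).trace * (pauli i * Y).trace := by
  simp [minkowski, pauli, Matrix.trace_fin_two, Matrix.mul_apply, Fin.sum_univ_two,
    Fin.sum_univ_three]
  linear_combination (X 1 0 - X 0 1) * (Y 1 0 - Y 0 1) * I_sq

lemma norm3_sq (v : Fin 3 → ℝ) : norm3 v ^ 2 = ∑ i, v i ^ 2 :=
  Real.sq_sqrt (Finset.sum_nonneg fun i _ => sq_nonneg (v i))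

lemma norm3_sq_lt_one {v : Fin 3 → ℝ} (hv : norm3 v < 1) : norm3 v ^ 2 < 1 :=
  (sq_lt_one_iff₀ (Real.sqrt_nonneg _)).2 hv

lemma QA_apply (ρ : Mat4) (hb : norm3 (bVec ρ) < 1) (i j : Fin 3) :
    QA ρ i j =
      ((aVec ρ i - ∑ k, Tmat ρ i k * bVec ρ k) * (aVec ρ j - ∑ k, Tmat ρ j k * bVec ρ k) /
        (1 - ∑ k, bVec ρ k * bVec ρ k) - (aVec ρ i * aVec ρ j - ∑ k, Tmat ρ i k * Tmat ρ j k)) /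
        (1 - ∑ k, bVec ρ k * bVec ρ k) := by
  have hg := (sub_pos.2 (norm3_sq_lt_one hb)).ne'
  have hs : norm3 (bVec ρ) ^ 2 = ∑ k, bVec ρ k * bVec ρ k := by
    simp only [norm3_sq, pow_two (bVec ρ _)]
  rw [QA, hs]
  rw [hs] at hg
  generalize aVec ρ = a at *
  generalize bVec ρ = b at *
  generalize Tmat ρ = T at *
  simp only [Matrix.smul_apply, Matrix.mul_apply, Matrix.add_apply, Matrix.sub_apply,
    vecMulVec_apply, Matrix.transpose_apply, smul_eq_mul, Fin.sum_univ_three] at hg ⊢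
  obtain ⟨g, hg'⟩ : ∃ g, g = 1 - (b 0 * b 0 + b 1 * b 1 + b 2 * b 2) := ⟨_, rfl⟩
  rw [← hg'] at hg ⊢
  simp
  field_simp
  linear_combination (a i * a j * (b 0 * b 0 + b 1 * b 1 + b 2 * b 2 + 1) -
    (T i 0 * b 0 + T i 1 * b 1 + T i 2 * b 2) * a j -
    a i * (T j 0 * b 0 + T j 1 * b 1 + T j 2 * b 2)) * hg'

lemma QA_eq_minkowski {ρ : Mat4} (hρ : ρ.IsHermitian) (htr : ρ.trace = 1)
    (hb : norm3 (bVec ρ) < 1) (i j : Fin 3) :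
    (QA ρ i j : ℂ) =
      (2 * minkowski (steered ρ (pauli i)) (steered ρ 1) *
        (2 * minkowski (steered ρ (pauli j)) (steered ρ 1)) /
        (2 * minkowski (steered ρ 1) (steered ρ 1)) -
        2 * minkowski (steered ρ (pauli i)) (steered ρ (pauli j))) /
        (2 * minkowski (steered ρ 1) (steered ρ 1)) := by
  have ha (i) : (aVec ρ i : ℂ) = (steered ρ (pauli i)).trace := by
    have := trace_mul_ofReal_re isHermitian_one (steered_isHermitian hρ (pauli_isHermitian i))
    rw [aVec, trace_kronecker_mul, this, one_mul]
  have hT (i k) : (Tmat ρ i k : ℂ) = (pauli k * steered ρ (pauli i)).trace := by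
    rw [Tmat, Matrix.of_apply, trace_kronecker_mul, trace_mul_ofReal_re (pauli_isHermitian k)
      (steered_isHermitian hρ (pauli_isHermitian i))]
  rw [QA_apply ρ hb]
  push_cast
  simp only [two_mul_minkowski, ha, bVec_ofReal hρ, hT, steered_one_trace, htr, mul_one]

/-- A Hermitian 2×2 matrix of trace zero has nonpositive determinant. -/
lemma minkowski_self_re_nonpos {X : Mat2} (hX : X.IsHermitian) (htr : X.trace = 0) :
    (minkowski X X).re ≤ 0 := by
  have h : (X * X).trace = ((X * Xᴴ).trace) := by rw [hX.eq]
  have := (Matrix.posSemidef_self_mul_conjTranspose X).trace_nonneg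
  rw [minkowski, htr, h]
  simpa using (Complex.nonneg_iff.1 this).1

lemma two_mul_minkowski_steered_one {ρ : Mat4} (hρ : ρ.IsHermitian) (htr : ρ.trace = 1) :
    2 * minkowski (steered ρ 1) (steered ρ 1) = ((1 - norm3 (bVec ρ) ^ 2 : ℝ) : ℂ) := by
  rw [two_mul_minkowski, steered_one_trace, htr, norm3_sq]
  push_cast
  simp only [bVec_ofReal hρ, sq, mul_one]

/-- Alice's QSE matrix is invariant under Bob-side local filtering. -/
theorem stmt_2 (ρ : Mat4) (hρ : IsState ρ) (hb : norm3 (bVec ρ) < 1)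
    (fB : Mat2) (hfB : IsUnit fB) (hb' : norm3 (bVec (filterB ρ fB)) < 1) :
    QA (filterB ρ fB) = QA ρ := by
  have hH : ρ.IsHermitian := hρ.1.isHermitian
  set N : ℂ := (((1 : Mat2) ⊗ₖ (fBᴴ * fB)) * ρ).trace with hN
  have hN_conj : N = (fB * steered ρ 1 * fBᴴ).trace := by
    rw [hN, trace_kronecker_mul, trace_mul_cycle, trace_mul_cycle, Matrix.mul_assoc]
  have hN_real : star N = N := by
    rw [hN_conj, ← trace_conjTranspose,
      (isHermitian_mul_mul_conjTranspose fB (steered_isHermitian hH isHermitian_one)).eq]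
  have hdet : fB.det ≠ 0 := ((isUnit_iff_isUnit_det fB).1 hfB).ne_zero
  have hN0 : N ≠ 0 := by
    intro h0
    have hle := minkowski_self_re_nonpos (isHermitian_mul_mul_conjTranspose fB
      (steered_isHermitian hH isHermitian_one)) (hN_conj.symm.trans h0)
    have h2 := two_mul_minkowski_steered_one hH hρ.2
    have hpos := sub_pos.2 (norm3_sq_lt_one hb)
    have hk : fB.det * fBᴴ.det = ((Complex.normSq fB.det : ℝ) : ℂ) := by
      rw [det_conjTranspose, Complex.normSq_eq_conj_mul_self, mul_comm]; rfl
    have hm : minkowski (steered ρ 1) (steered ρ 1) =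
        (((1 - norm3 (bVec ρ) ^ 2) / 2 : ℝ) : ℂ) := by
      rw [Complex.ofReal_div, ← h2]; push_cast; ring
    rw [minkowski_conj, hk, hm, ← Complex.ofReal_mul, Complex.ofReal_re] at hle
    have := mul_pos (Complex.normSq_pos.2 hdet) (half_pos hpos)
    linarith
  have hsteer (A : Mat2) : steered (filterB ρ fB) A = N⁻¹ • (fB * steered ρ A * fBᴴ) := by
    rw [filterB, steered_smul, steered_conj]
  have hH' : (filterB ρ fB).IsHermitian := by
    rw [filterB, ← hN]
    refine IsHermitian.smul (isHermitian_mul_mul_conjTranspose _ hH) ?_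
    rw [isSelfAdjoint_iff, star_inv₀, hN_real]
  have htr' : (filterB ρ fB).trace = 1 := by
    rw [← steered_one_trace, hsteer, trace_smul, ← hN_conj, smul_eq_mul, inv_mul_cancel₀ hN0]
  have hmink (A B : Mat2) : 2 * minkowski (steered (filterB ρ fB) A) (steered (filterB ρ fB) B) =
      N⁻¹ ^ 2 * (fB.det * fBᴴ.det) * (2 * minkowski (steered ρ A) (steered ρ B)) := by
    rw [hsteer, hsteer, minkowski_smul, minkowski_conj]
    ring
  have hk : N⁻¹ ^ 2 * (fB.det * fBᴴ.det) ≠ 0 := by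
    rw [det_conjTranspose]
    exact mul_ne_zero (pow_ne_zero _ (inv_ne_zero hN0)) (mul_ne_zero hdet (star_ne_zero.2 hdet))
  have hg : 2 * minkowski (steered ρ 1) (steered ρ 1) ≠ 0 := by
    rw [two_mul_minkowski_steered_one hH hρ.2, Complex.ofReal_ne_zero]
    exact (sub_pos.2 (norm3_sq_lt_one hb)).ne'
  ext i j
  apply Complex.ofReal_injective
  rw [QA_eq_minkowski hH' htr' hb', QA_eq_minkowski hH hρ.2 hb]
  simp only [hmink]
  generalize N⁻¹ ^ 2 * (fB.det * fBᴴ.det) = c at *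
  generalize 2 * minkowski (steered ρ 1) (steered ρ 1) = g at *
  field_simp

end
end

section
/- Let θ ∈ (0, π/4], p ∈ [0,1], and let ρ_M(θ,p) = p φ⁺(θ) + (1−p) ρ_A(θ)⊗(𝟙/2). With the local filter f_A = diag(tanθ, 1) applied on Alice's side only, the filtered state equals the isotropic state: (f_A⊗𝟙) ρ_M(θ,p) (f_A⊗𝟙)† / tr[(f_A†f_A⊗𝟙) ρ_M(θ,p)] = p Φ⁺ + (1−p)(𝟙₄/4), where Φ⁺ = |Φ⁺⟩⟨Φ⁺| and |Φ⁺⟩ = (|00⟩+|11⟩)/√2. In particular, Alice alone can bring ρ_M(θ,p) to its Bell-diagonal form by local filtering. -/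
open Matrix Kronecker Complex
open scoped ComplexOrder

noncomputable section

theorem inv_sqrt_two_mul_self :
    ((Real.sqrt 2 : ℝ) : ℂ)⁻¹ * ((Real.sqrt 2 : ℝ) : ℂ)⁻¹ = 1 / 2 := by
  rw [← mul_inv, ← ofReal_mul, Real.mul_self_sqrt (by norm_num)]
  norm_num

/-- The unnormalized filtered state is `2 sin² θ` times the isotropic state. -/
theorem filter_mul_rhoM_mul_filter (θ p : ℝ) (hc : Real.cos θ ≠ 0) :
    (!![(Real.tan θ : ℂ), 0; 0, 1] ⊗ₖ (1 : Mat2)) * rhoM θ p *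
        (!![(Real.tan θ : ℂ), 0; 0, 1] ⊗ₖ (1 : Mat2))ᴴ =
      (2 * (Real.sin θ : ℂ) ^ 2) •
        ((p : ℂ) • maxEntProj + ((1 - p : ℝ) : ℂ) • ((1 / 4 : ℂ) • (1 : Mat4))) := by
  have ht : (Real.sin θ : ℂ) = Real.tan θ * Real.cos θ := by
    exact_mod_cast (Real.tan_mul_cos hc).symm
  ext ⟨i, j⟩ ⟨k, l⟩
  fin_cases i <;> fin_cases j <;> fin_cases k <;> fin_cases l <;>
    simp [Matrix.mul_apply, Fintype.sum_prod_type, Fin.sum_univ_two, rhoM, phiProj, phiVec,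
      rhoA, maxEntProj, maxEntVec, vecMulVec_apply, one_apply, conj_ofReal, inv_sqrt_two_mul_self,
      -ofReal_sin, -ofReal_cos, -ofReal_tan, -mul_eq_mul_left_iff] <;>
    rw [ht] <;> ring

/-- The isotropic state has unit trace. -/
theorem trace_isotropic (p : ℝ) :
    ((p : ℂ) • maxEntProj + ((1 - p : ℝ) : ℂ) • ((1 / 4 : ℂ) • (1 : Mat4))).trace = 1 := by
  simp [trace, Fintype.sum_prod_type, Fin.sum_univ_two, maxEntProj, maxEntVec, vecMulVec_apply,
    conj_ofReal, inv_sqrt_two_mul_self]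
  ring

/-- The filtering probability is the trace of the unnormalized filtered state. -/
theorem trace_filter (ρ : Mat4) (f : Mat2) :
    ((f ⊗ₖ (1 : Mat2)) * ρ * (f ⊗ₖ (1 : Mat2))ᴴ).trace =
      (((fᴴ * f) ⊗ₖ (1 : Mat2)) * ρ).trace := by
  rw [trace_mul_comm, ← Matrix.mul_assoc, conjTranspose_kronecker, ← mul_kronecker_mul,
    conjTranspose_one, Matrix.one_mul]

/-- the Alice-side filter f_A = diag(tanθ, 1) brings ρ_M(θ,p) to the
isotropic state pΦ⁺ + (1−p)𝟙₄/4. -/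
theorem stmt_12 (θ p : ℝ) (hθ₀ : 0 < θ) (hθ₁ : θ ≤ Real.pi / 4)
    (hp₀ : 0 ≤ p) (hp₁ : p ≤ 1) :
    filterA (rhoM θ p) !![(Real.tan θ : ℂ), 0; 0, 1] =
      (p : ℂ) • maxEntProj + ((1 - p : ℝ) : ℂ) • ((1 / 4 : ℂ) • (1 : Mat4)) := by
  have hc : Real.cos θ ≠ 0 :=
    (Real.cos_pos_of_mem_Ioo ⟨by linarith [Real.pi_pos], by linarith [Real.pi_pos]⟩).ne'
  have hs : (Real.sin θ : ℂ) ≠ 0 := by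
    exact_mod_cast (Real.sin_pos_of_pos_of_lt_pi hθ₀ (by linarith [Real.pi_pos])).ne'
  have key := filter_mul_rhoM_mul_filter θ p hc
  have htr : (((!![(Real.tan θ : ℂ), 0; 0, 1]ᴴ * !![(Real.tan θ : ℂ), 0; 0, 1]) ⊗ₖ
      (1 : Mat2)) * rhoM θ p).trace = 2 * (Real.sin θ : ℂ) ^ 2 := by
    rw [← trace_filter, key, trace_smul, trace_isotropic, smul_eq_mul, mul_one]
  rw [filterA, htr, key, smul_smul, inv_mul_cancel₀ (by positivity), one_smul]

end
end
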